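/- Let M(λ) = M_0 + M_1λ + ⋯ + M_dλ^d ∈ F[λ]^{m×(m+n)} be a polynomial matrix and let S_k be its Sylvester matrices for k = 1, 2, .... Then M(λ) is a minimal basis with rank(M_d) = m if and only if there exists an index k such that S_k has full row rank (k+d)m. In that case, if d' is the smallest index k for which S_k has full row rank, then d' is the largest right minimal index of M(λ). -/

import Mathlib

open Polynomial Matrix

noncomputable section

variable {F : Type*} [Field F]

/-- The rows of a polynomial matrix, viewed as vectors of rational functions. -/
def ratRow {p q : ℕ} (M : Matrix (Fin p) (Fin q) F[X]) (i : Fin p) :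
    Fin q → RatFunc F :=
  fun j => algebraMap F[X] (RatFunc F) (M i j)

/-- The rational vector subspace spanned by the rows of a polynomial matrix. -/
def rowSpan {p q : ℕ} (M : Matrix (Fin p) (Fin q) F[X]) :
    Submodule (RatFunc F) (Fin q → RatFunc F) :=
  Submodule.span (RatFunc F) (Set.range (ratRow M))

/-- The degree of the `i`-th row of a polynomial matrix. -/
def rowDeg {p q : ℕ} (M : Matrix (Fin p) (Fin q) F[X]) (i : Fin p) : ℕ :=
  Finset.univ.sup fun j => (M i j).natDegree

/-- The rows of `M` form a polynomial basis of the rational subspace `V` whose sum of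
row degrees is minimal among all polynomial bases of `V`. -/
def IsMinimalBasisOf {p q : ℕ} (V : Submodule (RatFunc F) (Fin q → RatFunc F))
    (M : Matrix (Fin p) (Fin q) F[X]) : Prop :=
  LinearIndependent (RatFunc F) (ratRow M) ∧ rowSpan M = V ∧
    ∀ M' : Matrix (Fin p) (Fin q) F[X],
      LinearIndependent (RatFunc F) (ratRow M') → rowSpan M' = V →
        ∑ i, rowDeg M i ≤ ∑ i, rowDeg M' i

/-- A polynomial matrix is a minimal basis if its rows form a minimal basis of the
rational subspace they span. -/
def IsMinimalBasis {p q : ℕ} (M : Matrix (Fin p) (Fin q) F[X]) : Prop :=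
  IsMinimalBasisOf (rowSpan M) M

/-- A polynomial matrix viewed as a matrix of rational functions. -/
def ratMat {p q : ℕ} (M : Matrix (Fin p) (Fin q) F[X]) :
    Matrix (Fin p) (Fin q) (RatFunc F) :=
  M.map (algebraMap F[X] (RatFunc F))

/-- The right null-space over `F(λ)` of a polynomial matrix. -/
def rightNullSpace {p q : ℕ} (M : Matrix (Fin p) (Fin q) F[X]) :
    Submodule (RatFunc F) (Fin q → RatFunc F) :=
  LinearMap.ker (Matrix.mulVecLin (ratMat M))

/-- The `k`-th Sylvester matrix of a polynomial matrix regarded as having degree at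
most `e`: the block-Toeplitz matrix with `k` block columns whose `j`-th block column
carries the coefficients `M_0, …, M_e` in block rows `j, …, j+e` and zeros elsewhere. -/
def sylv {p q : ℕ} (e k : ℕ) (M : Matrix (Fin p) (Fin q) F[X]) :
    Matrix (Fin (k + e) × Fin p) (Fin k × Fin q) F :=
  fun r c =>
    if (c.1 : ℕ) ≤ (r.1 : ℕ) ∧ (r.1 : ℕ) ≤ (c.1 : ℕ) + e then
      (M r.2 c.2).coeff ((r.1 : ℕ) - (c.1 : ℕ))
    else 0

/-- `M`, regarded as a polynomial matrix of degree at most `e`, has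
full-Sylvester-rank if every Sylvester matrix `S_k`, `k ≥ 1`, has full rank. -/
def HasFullSylvesterRank {p q : ℕ} (e : ℕ) (M : Matrix (Fin p) (Fin q) F[X]) : Prop :=
  ∀ k : ℕ, 1 ≤ k → (sylv e k M).rank = min ((k + e) * p) (k * q)

/-- The `k`-th coefficient matrix of a polynomial matrix. -/
def coeffMat {p q : ℕ} (k : ℕ) (M : Matrix (Fin p) (Fin q) F[X]) :
    Matrix (Fin p) (Fin q) F :=
  fun i j => (M i j).coeff k

/-- The highest-row-degree coefficient matrix: its `i`-th row is the coefficient of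
`λ^{d_i}` in the `i`-th row of `M`, where `d_i` is the `i`-th row degree. -/
def highRowMat {p q : ℕ} (M : Matrix (Fin p) (Fin q) F[X]) :
    Matrix (Fin p) (Fin q) F :=
  fun i j => (M i j).coeff (rowDeg M i)

/-- The `e`-reversal of a polynomial matrix: `rev_e P(λ) = λ^e P(1/λ)`. -/
def revMat {p q : ℕ} (e : ℕ) (P : Matrix (Fin p) (Fin q) F[X]) :
    Matrix (Fin p) (Fin q) F[X] :=
  fun i j => (P i j).reflect e


variable {p q : ℕ}

lemma natDegree_le_rowDeg (M : Matrix (Fin p) (Fin q) F[X]) (i : Fin p) (j : Fin q) :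
    (M i j).natDegree ≤ rowDeg M i :=
  Finset.le_sup (f := fun j => (M i j).natDegree) (Finset.mem_univ j)

lemma ratRow_combination (M : Matrix (Fin p) (Fin q) F[X]) (b : Fin p → F[X]) :
    ∑ i, algebraMap F[X] (RatFunc F) (b i) • ratRow M i =
      fun j => algebraMap F[X] (RatFunc F) ((b ᵥ* M) j) := by
  ext j
  simp [ratRow, Matrix.vecMul, dotProduct, Finset.sum_apply, Algebra.smul_def]

lemma algebraMap_vecMul_mem_rowSpan (M : Matrix (Fin p) (Fin q) F[X]) (b : Fin p → F[X]) :
    (fun j => algebraMap F[X] (RatFunc F) ((b ᵥ* M) j)) ∈ rowSpan M := by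
  rw [← ratRow_combination]
  exact Submodule.sum_mem _ fun i _ =>
    Submodule.smul_mem _ _ (Submodule.subset_span (Set.mem_range_self i))

lemma vecMul_eq_zero_of_linearIndependent {M : Matrix (Fin p) (Fin q) F[X]}
    (hM : LinearIndependent (RatFunc F) (ratRow M)) {b : Fin p → F[X]} (hb : b ᵥ* M = 0) :
    b = 0 := by
  have h := Fintype.linearIndependent_iff.1 hM (fun i => algebraMap F[X] (RatFunc F) (b i))
    (by rw [ratRow_combination, hb]; ext j; simp)
  ext1 i
  simpa using h i

/-- Replacing a row of a polynomial basis by a vector whose expansion involves that row gives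
another polynomial basis of the same rational subspace. -/
lemma linearIndependent_updateRow {M : Matrix (Fin p) (Fin q) F[X]}
    (hM : LinearIndependent (RatFunc F) (ratRow M)) {x : Fin q → F[X]} {b : Fin p → F[X]}
    {s : F[X]} (hs : s ≠ 0) (hx : s • x = b ᵥ* M) {i₀ : Fin p} (hb : b i₀ ≠ 0) :
    LinearIndependent (RatFunc F) (ratRow (M.updateRow i₀ x)) ∧
      rowSpan (M.updateRow i₀ x) = rowSpan M := by
  set xr : Fin q → RatFunc F := fun j => algebraMap F[X] (RatFunc F) (x j) with hxr
  have hs' : algebraMap F[X] (RatFunc F) s ≠ 0 := by simpa using hs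
  have hb' : algebraMap F[X] (RatFunc F) (b i₀) ≠ 0 := by simpa using hb
  have hsx : algebraMap F[X] (RatFunc F) s • xr =
      ∑ i, algebraMap F[X] (RatFunc F) (b i) • ratRow M i := by
    rw [ratRow_combination, ← hx]
    ext j
    simp [hxr]
  have hself : ratRow (M.updateRow i₀ x) i₀ = xr := by
    ext j; simp [ratRow, hxr]
  have hne : ∀ i, i ≠ i₀ → ratRow (M.updateRow i₀ x) i = ratRow M i := by
    intro i hi; ext j; simp [ratRow, Matrix.updateRow_ne hi]
  have hspan : rowSpan (M.updateRow i₀ x) = rowSpan M := by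
    apply le_antisymm
    · refine Submodule.span_le.2 ?_
      rintro _ ⟨i, rfl⟩
      by_cases hi : i = i₀
      · subst hi
        rw [hself, SetLike.mem_coe, ← Submodule.smul_mem_iff _ hs', hsx]
        exact Submodule.sum_mem _ fun i _ =>
          Submodule.smul_mem _ _ (Submodule.subset_span (Set.mem_range_self i))
      · rw [hne i hi]
        exact Submodule.subset_span (Set.mem_range_self i)
    · refine Submodule.span_le.2 ?_
      rintro _ ⟨i, rfl⟩
      have hmem : ∀ i, ratRow (M.updateRow i₀ x) i ∈ rowSpan (M.updateRow i₀ x) := fun i =>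
        Submodule.subset_span (Set.mem_range_self i)
      by_cases hi : i = i₀
      · subst hi
        rw [← Finset.add_sum_erase _ _ (Finset.mem_univ i)] at hsx
        rw [SetLike.mem_coe, ← Submodule.smul_mem_iff _ hb', ← sub_eq_of_eq_add hsx, ← hself]
        refine Submodule.sub_mem _ (Submodule.smul_mem _ _ (hmem i)) ?_
        refine Submodule.sum_mem _ fun l hl => Submodule.smul_mem _ _ ?_
        rw [← hne l (Finset.ne_of_mem_erase hl)]
        exact hmem l
      · rw [← hne i hi]
        exact hmem i
  refine ⟨?_, hspan⟩
  rw [linearIndependent_iff_card_eq_finrank_span] at hM ⊢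
  rw [hM]
  exact congrArg (fun W : Submodule _ _ => Module.finrank (RatFunc F) W) hspan.symm

/-- A vector whose expansion in a minimal basis involves a given row has at least the degree
of that row. -/
lemma IsMinimalBasisOf.exists_rowDeg_le_degree {V : Submodule (RatFunc F) (Fin q → RatFunc F)}
    {M : Matrix (Fin p) (Fin q) F[X]} (hM : IsMinimalBasisOf V M) {x : Fin q → F[X]}
    {b : Fin p → F[X]} {s : F[X]} (hs : s ≠ 0) (hx : s • x = b ᵥ* M) {i₀ : Fin p}
    (hb : b i₀ ≠ 0) : ∃ j, (rowDeg M i₀ : WithBot ℕ) ≤ (x j).degree := by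
  by_contra! hlt
  obtain ⟨hli, hspan⟩ := linearIndependent_updateRow hM.1 hs hx hb
  have hx0 : x ≠ 0 := by
    rintro rfl
    refine hb (congrFun (vecMul_eq_zero_of_linearIndependent hM.1 ?_) i₀)
    rw [← hx, smul_zero]
  obtain ⟨j₀, hj₀⟩ := Function.ne_iff.1 hx0
  have hpos : 0 < rowDeg M i₀ := by
    have h1 := hlt j₀
    rw [degree_eq_natDegree hj₀] at h1
    exact (Nat.zero_le _).trans_lt (Nat.cast_lt.1 h1)
  have hlt' : rowDeg (M.updateRow i₀ x) i₀ < rowDeg M i₀ := by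
    refine (Finset.sup_lt_iff hpos).2 fun j _ => ?_
    rw [Matrix.updateRow_self]
    by_cases hj : x j = 0
    · simpa [hj] using hpos
    · exact (natDegree_lt_iff_degree_lt hj).2 (hlt j)
  refine absurd (hM.2.2 _ hli (hspan.trans hM.2.1)) (not_le.2 ?_)
  refine Finset.sum_lt_sum (fun i _ => ?_) ⟨i₀, Finset.mem_univ _, hlt'⟩
  by_cases hi : i = i₀
  · exact hi ▸ hlt'.le
  · simp [rowDeg, Matrix.updateRow_ne hi]

lemma exists_smul_eq_vecMul {M : Matrix (Fin p) (Fin q) F[X]} {x : Fin q → F[X]}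
    (hx : (fun j => algebraMap F[X] (RatFunc F) (x j)) ∈ rowSpan M) :
    ∃ (s : F[X]) (b : Fin p → F[X]), s ≠ 0 ∧ s • x = b ᵥ* M := by
  rw [rowSpan, Submodule.mem_span_range_iff_exists_fun] at hx
  obtain ⟨c, hc⟩ := hx
  obtain ⟨⟨s, hs⟩, hsc⟩ := IsLocalization.exist_integer_multiples_of_finite
    (nonZeroDivisors F[X]) c
  choose b hb using hsc
  refine ⟨s, b, nonZeroDivisors.ne_zero hs, ?_⟩
  ext1 j
  apply IsFractionRing.injective F[X] (RatFunc F)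
  have h := congrFun (ratRow_combination M b) j
  rw [← h]
  simp only [hb, Algebra.smul_def s, mul_smul, ← Finset.smul_sum, hc]
  simp

/-- Polynomial vectors in a rational subspace are polynomial combinations of the rows of a
minimal basis. -/
lemma IsMinimalBasisOf.exists_eq_vecMul {V : Submodule (RatFunc F) (Fin q → RatFunc F)}
    {M : Matrix (Fin p) (Fin q) F[X]} (hM : IsMinimalBasisOf V M) {x : Fin q → F[X]}
    (hx : (fun j => algebraMap F[X] (RatFunc F) (x j)) ∈ V) : ∃ a : Fin p → F[X], a ᵥ* M = x := by
  rw [← hM.2.1] at hx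
  obtain ⟨s, b, hs0, hsx⟩ := exists_smul_eq_vecMul hx
  have hrem : s • (x - (fun i => b i / s) ᵥ* M) = (fun i => b i % s) ᵥ* M := by
    have h : b = s • (fun i => b i / s) + fun i => b i % s := by
      ext1 i
      simp [EuclideanDomain.div_add_mod]
    rw [smul_sub, hsx, ← Matrix.smul_vecMul, sub_eq_iff_eq_add', ← Matrix.add_vecMul, ← h]
  by_cases hzero : ∀ i, b i % s = 0
  · refine ⟨fun i => b i / s, ?_⟩
    have h0 : (fun i => b i % s) = 0 := funext hzero
    rw [h0, Matrix.zero_vecMul, smul_eq_zero_iff_right hs0] at hrem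
    exact (sub_eq_zero.1 hrem).symm
  · exfalso
    classical
    push Not at hzero
    obtain ⟨i₀, hi₀, hmax⟩ := Finset.exists_max_image
      (Finset.univ.filter fun i => b i % s ≠ 0) (rowDeg M) (by simpa [Finset.Nonempty] using hzero)
    simp only [Finset.mem_filter, Finset.mem_univ, true_and] at hi₀ hmax
    obtain ⟨j, hj⟩ := hM.exists_rowDeg_le_degree hs0 hrem hi₀
    have hdeg := congrArg degree (congrFun hrem j)
    rw [Pi.smul_apply, smul_eq_mul, degree_mul, degree_eq_natDegree hs0] at hdeg
    have hlt : (((fun i => b i % s) ᵥ* M) j).degree < ↑(s.natDegree + rowDeg M i₀) := by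
      rw [Matrix.vecMul, dotProduct]
      refine (degree_sum_le _ _).trans_lt ((Finset.sup_lt_iff (WithBot.bot_lt_coe _)).2 ?_)
      intro i _
      by_cases hi : b i % s = 0
      · simp [hi]
      · have h1 : (b i % s).natDegree < s.natDegree :=
          natDegree_lt_natDegree hi (EuclideanDomain.mod_lt _ hs0)
        have h2 := (natDegree_le_rowDeg M i j).trans (hmax i hi)
        refine degree_le_natDegree.trans_lt (Nat.cast_lt.2 ?_)
        have := natDegree_mul_le (p := b i % s) (q := M i j)
        omega
    rw [← hdeg, Nat.cast_add] at hlt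
    exact absurd hlt (not_lt.2 (by gcongr))

/-- The highest-row-degree coefficient matrix of a minimal basis has full row rank. -/
lemma IsMinimalBasisOf.vecMul_highRowMat {V : Submodule (RatFunc F) (Fin q → RatFunc F)}
    {M : Matrix (Fin p) (Fin q) F[X]} (hM : IsMinimalBasisOf V M) {c : Fin p → F}
    (hc : c ᵥ* highRowMat M = 0) : c = 0 := by
  classical
  by_contra hne
  obtain ⟨i₀, hi₀, hmax⟩ := Finset.exists_max_image
    (Finset.univ.filter fun i => c i ≠ 0) (rowDeg M)
    (by simpa [Finset.Nonempty] using Function.ne_iff.1 hne)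
  simp only [Finset.mem_filter, Finset.mem_univ, true_and] at hi₀ hmax
  set b : Fin p → F[X] := fun i => C (c i) * X ^ (rowDeg M i₀ - rowDeg M i) with hb
  obtain ⟨j, hj⟩ := hM.exists_rowDeg_le_degree (x := b ᵥ* M) one_ne_zero (one_smul _ _)
    (i₀ := i₀) (by simpa [hb] using hi₀)
  refine absurd hj (not_le.2 ((degree_lt_iff_coeff_zero _ _).2 fun t ht => ?_))
  have hterm : ∀ i, (b i * M i j).coeff t =
      if t = rowDeg M i₀ then c i * (M i j).coeff (rowDeg M i) else 0 := by
    intro i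
    by_cases hi : c i = 0
    · simp [hb, hi]
    · have hle := hmax i hi
      simp only [hb, mul_assoc, coeff_C_mul, coeff_X_pow_mul']
      rw [if_pos (by omega)]
      split_ifs with h
      · rw [h, Nat.sub_sub_self hle]
      · rw [coeff_eq_zero_of_natDegree_lt, mul_zero]
        have := natDegree_le_rowDeg M i j
        omega
  simp only [Matrix.vecMul, dotProduct, finsetSum_coeff, hterm]
  split_ifs
  · exact congrFun hc j
  · simp

/-- Predictable degree property of minimal bases. -/
lemma IsMinimalBasisOf.natDegree_add_rowDeg_lt
    {V : Submodule (RatFunc F) (Fin q → RatFunc F)} {M : Matrix (Fin p) (Fin q) F[X]}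
    (hM : IsMinimalBasisOf V M) {a : Fin p → F[X]} {k : ℕ}
    (ha : ∀ j, ((a ᵥ* M) j).degree < k) {i : Fin p} (hi : a i ≠ 0) :
    (a i).natDegree + rowDeg M i < k := by
  classical
  by_contra! hk
  obtain ⟨i₀, hi₀, hmax⟩ := Finset.exists_max_image
    (Finset.univ.filter fun i => a i ≠ 0) (fun i => (a i).natDegree + rowDeg M i)
    ⟨i, by simpa using hi⟩
  simp only [Finset.mem_filter, Finset.mem_univ, true_and] at hi₀ hmax
  set t := (a i₀).natDegree + rowDeg M i₀ with ht
  have hkt : k ≤ t := hk.trans (hmax i hi)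
  set c : Fin p → F := fun i => if rowDeg M i ≤ t then (a i).coeff (t - rowDeg M i) else 0
  have hc : c = 0 := by
    refine hM.vecMul_highRowMat ?_
    ext j
    have h0 := coeff_eq_zero_of_degree_lt ((ha j).trans_le (Nat.cast_le.2 hkt))
    rw [Pi.zero_apply, ← h0]
    simp only [Matrix.vecMul, dotProduct, finsetSum_coeff]
    refine Finset.sum_congr rfl fun l _ => ?_
    by_cases hl : a l = 0
    · simp [c, hl]
    · have hle := hmax l hl
      have h1 : rowDeg M l ≤ t := by omega
      have h2 := coeff_mul_add_eq_of_natDegree_le (f := a l) (g := M l j)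
        (df := t - rowDeg M l) (dg := rowDeg M l) (by omega) (natDegree_le_rowDeg M l j)
      rw [Nat.sub_add_cancel h1] at h2
      simp only [c, if_pos h1, highRowMat, h2]
  have h := congrFun hc i₀
  simp only [c, ht, Nat.le_add_left, if_true, Nat.add_sub_cancel, Pi.zero_apply,
    coeff_natDegree, leadingCoeff_eq_zero] at h
  exact hi₀ h

/-- If the coefficient matrix of degree `d` has trivial left null-space, left multiplication by
a nonzero polynomial vector does not lower the degree below `d`. -/
lemma exists_le_natDegree_vecMul {d : ℕ} {M : Matrix (Fin p) (Fin q) F[X]}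
    (hdeg : ∀ i j, (M i j).natDegree ≤ d) (hM : ∀ c, c ᵥ* coeffMat d M = 0 → c = 0)
    {a : Fin p → F[X]} (ha : a ≠ 0) : ∃ j, d ≤ ((a ᵥ* M) j).natDegree := by
  classical
  obtain ⟨i₀, hi₀, hmax⟩ := Finset.exists_max_image
    (Finset.univ.filter fun i => a i ≠ 0) (fun i => (a i).natDegree)
    (by simpa [Finset.Nonempty] using Function.ne_iff.1 ha)
  simp only [Finset.mem_filter, Finset.mem_univ, true_and] at hi₀ hmax
  set t := (a i₀).natDegree with ht
  have hle : ∀ i, (a i).natDegree ≤ t := by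
    intro i
    by_cases hi : a i = 0
    · simp [hi]
    · exact hmax i hi
  have hne : (fun i => (a i).coeff t) ᵥ* coeffMat d M ≠ 0 := fun h => by
    have := congrFun (hM _ h) i₀
    simp [ht, hi₀] at this
  obtain ⟨j, hj⟩ := Function.ne_iff.1 hne
  refine ⟨j, le_trans (Nat.le_add_left d t) (le_natDegree_of_ne_zero ?_)⟩
  rw [Pi.zero_apply] at hj
  convert hj using 1
  simp only [Matrix.vecMul, dotProduct, finsetSum_coeff]
  exact Finset.sum_congr rfl fun i _ => coeff_mul_add_eq_of_natDegree_le (hle i) (hdeg i j)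

lemma rank_eq_card_rows_iff {A : Matrix (Fin p) (Fin q) F} :
    A.rank = p ↔ ∀ c, c ᵥ* A = 0 → c = 0 := by
  have hli : LinearIndependent F A.row ↔ ∀ c, c ᵥ* A = 0 → c = 0 := by
    rw [← Matrix.vecMul_injective_iff]
    exact injective_iff_map_eq_zero A.vecMulLinear
  rw [← hli, Matrix.rank_eq_finrank_span_row, linearIndependent_iff_card_eq_finrank_span,
    Fintype.card_fin, eq_comm]
  rfl

lemma rank_eq_card_iff_mulVec_surjective {ι κ : Type*} [Fintype ι] [Fintype κ] {A : Matrix ι κ F} :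
    A.rank = Fintype.card ι ↔ Function.Surjective A.mulVec := by
  rw [← Matrix.coe_mulVecLin, ← LinearMap.range_eq_top, Matrix.rank,
    ← Module.finrank_fintype_fun_eq_card F]
  exact ⟨Submodule.eq_top_of_finrank_eq, fun h => by rw [h, finrank_top]⟩

/-- The vector of polynomials of degree less than `k` with prescribed coefficients. -/
def polyVec {k : ℕ} (c : Fin k × Fin q → F) : Fin q → F[X] :=
  fun j => ∑ l : Fin k, C (c (l, j)) * X ^ (l : ℕ)

lemma coeff_polyVec {k : ℕ} (c : Fin k × Fin q → F) (j : Fin q) (l : Fin k) :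
    (polyVec c j).coeff l = c (l, j) := by
  simp [polyVec, coeff_X_pow, Fin.val_inj]

lemma degree_polyVec_lt {k : ℕ} (c : Fin k × Fin q → F) (j : Fin q) :
    (polyVec c j).degree < k :=
  degree_sum_fin_lt fun l => c (l, j)

lemma polyVec_coeff {k : ℕ} {x : Fin q → F[X]} (hx : ∀ j, (x j).degree < k) :
    polyVec (fun lj : Fin k × Fin q => (x lj.2).coeff lj.1) = x := by
  ext j t
  by_cases ht : t < k
  · exact coeff_polyVec _ j ⟨t, ht⟩
  · rw [coeff_eq_zero_of_degree_lt ((degree_polyVec_lt _ j).trans_le _),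
      coeff_eq_zero_of_degree_lt ((hx j).trans_le _)] <;> exact_mod_cast not_lt.1 ht

lemma degree_mulVec_lt {ι : Type*} {e k : ℕ} {M : Matrix ι (Fin q) F[X]}
    (hdeg : ∀ i j, (M i j).natDegree ≤ e) {x : Fin q → F[X]} (hx : ∀ j, (x j).degree < k)
    (i : ι) : ((M *ᵥ x) i).degree < ((k + e : ℕ) : WithBot ℕ) := by
  rw [Matrix.mulVec, dotProduct]
  refine (degree_sum_le _ _).trans_lt ((Finset.sup_lt_iff (WithBot.bot_lt_coe _)).2 ?_)
  intro j _
  by_cases hj : x j = 0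
  · simp [hj]
  · refine degree_le_natDegree.trans_lt (Nat.cast_lt.2 ?_)
    have h1 := natDegree_mul_le (p := M i j) (q := x j)
    have h2 := (natDegree_lt_iff_degree_lt hj).2 (hx j)
    have h3 := hdeg i j
    omega

/-- Sylvester matrices represent multiplication by `M` on vectors of polynomials. -/
lemma sylv_mulVec {e k : ℕ} {M : Matrix (Fin p) (Fin q) F[X]}
    (hdeg : ∀ i j, (M i j).natDegree ≤ e) (c : Fin k × Fin q → F) (r : Fin (k + e) × Fin p) :
    (sylv e k M *ᵥ c) r = ((M *ᵥ polyVec c) r.2).coeff r.1 := by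
  simp only [Matrix.mulVec, dotProduct, Fintype.sum_prod_type_right, finsetSum_coeff, polyVec,
    Finset.mul_sum]
  refine Finset.sum_congr rfl fun j _ => Finset.sum_congr rfl fun l _ => ?_
  rw [← mul_assoc, coeff_mul_X_pow', coeff_mul_C]
  simp only [sylv]
  by_cases h1 : (l : ℕ) ≤ r.1
  · by_cases h2 : (r.1 : ℕ) ≤ l + e
    · simp [h1, h2]
    · rw [coeff_eq_zero_of_natDegree_lt ((hdeg r.2 j).trans_lt (by omega))]
      simp [h2]
  · simp [h1]

lemma sylv_mulVec_eq_zero_iff {e k : ℕ} {M : Matrix (Fin p) (Fin q) F[X]}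
    (hdeg : ∀ i j, (M i j).natDegree ≤ e) (c : Fin k × Fin q → F) :
    sylv e k M *ᵥ c = 0 ↔ M *ᵥ polyVec c = 0 := by
  constructor
  · intro h
    rw [← polyVec_coeff (degree_mulVec_lt hdeg (degree_polyVec_lt c))]
    have : (fun r : Fin (k + e) × Fin p => ((M *ᵥ polyVec c) r.2).coeff r.1) = 0 := by
      rw [← h]
      exact funext fun r => (sylv_mulVec hdeg c r).symm
    rw [this]
    ext1 i
    simp [polyVec]
  · intro h
    ext1 r
    simp [sylv_mulVec hdeg, h]

lemma rank_sylv_eq_iff {e k : ℕ} {M : Matrix (Fin p) (Fin q) F[X]}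
    (hdeg : ∀ i j, (M i j).natDegree ≤ e) :
    (sylv e k M).rank = (k + e) * p ↔
      ∀ y : Fin p → F[X], (∀ i, (y i).degree < ((k + e : ℕ) : WithBot ℕ)) →
        ∃ x : Fin q → F[X], (∀ j, (x j).degree < k) ∧ M *ᵥ x = y := by
  have hcard : (k + e) * p = Fintype.card (Fin (k + e) × Fin p) := by simp
  rw [hcard, rank_eq_card_iff_mulVec_surjective]
  constructor
  · intro h y hy
    obtain ⟨c, hc⟩ := h fun r => (y r.2).coeff r.1
    refine ⟨polyVec c, degree_polyVec_lt c, ?_⟩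
    rw [← polyVec_coeff (degree_mulVec_lt hdeg (degree_polyVec_lt c)), ← polyVec_coeff hy, ← hc]
    congr 1
    exact funext fun r => (sylv_mulVec hdeg c r).symm
  · intro h y
    obtain ⟨x, hx, hxy⟩ := h (polyVec y) (degree_polyVec_lt y)
    refine ⟨fun lj => (x lj.2).coeff lj.1, ?_⟩
    ext1 r
    rw [sylv_mulVec hdeg, polyVec_coeff hx, hxy, coeff_polyVec]

lemma mem_rightNullSpace_iff {M : Matrix (Fin p) (Fin q) F[X]} {x : Fin q → F[X]} :
    (fun j => algebraMap F[X] (RatFunc F) (x j)) ∈ rightNullSpace M ↔ M *ᵥ x = 0 := by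
  rw [rightNullSpace, LinearMap.mem_ker, Matrix.mulVecLin_apply, ratMat, funext_iff, funext_iff]
  refine forall_congr' fun i => ?_
  rw [Pi.zero_apply, Pi.zero_apply,
    ← map_eq_zero_iff (algebraMap F[X] (RatFunc F)) (IsFractionRing.injective F[X] (RatFunc F))]
  simp [Matrix.mulVec, dotProduct]

/-- The coefficients of the polynomial combinations of the rows of `N`. -/
def vecMulCoeff {n : ℕ} (N : Matrix (Fin n) (Fin q) F[X]) (k : ℕ) :
    (Fin n → F[X]) →ₗ[F] (Fin k × Fin q → F) where
  toFun a lj := ((a ᵥ* N) lj.2).coeff lj.1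
  map_add' a b := by
    ext lj
    simp [Matrix.add_vecMul]
  map_smul' c a := by
    ext lj
    simp [Matrix.smul_vecMul]

lemma degree_vecMul_lt {n k : ℕ} {N : Matrix (Fin n) (Fin q) F[X]} {a : Fin n → F[X]}
    (ha : ∀ i, a i ∈ degreeLT F (k - rowDeg N i)) (j : Fin q) : ((a ᵥ* N) j).degree < k := by
  rw [Matrix.vecMul, dotProduct]
  refine (degree_sum_le _ _).trans_lt ((Finset.sup_lt_iff (WithBot.bot_lt_coe _)).2 ?_)
  intro i _
  by_cases hi : a i = 0
  · simp [hi]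
  · refine degree_le_natDegree.trans_lt (Nat.cast_lt.2 ?_)
    have h1 := natDegree_mul_le (p := a i) (q := N i j)
    have h2 := (natDegree_lt_iff_degree_lt hi).2 (mem_degreeLT.1 (ha i))
    have h3 := natDegree_le_rowDeg N i j
    omega

lemma polyVec_vecMulCoeff {n k : ℕ} {N : Matrix (Fin n) (Fin q) F[X]} {a : Fin n → F[X]}
    (ha : ∀ i, a i ∈ degreeLT F (k - rowDeg N i)) : polyVec (vecMulCoeff N k a) = a ᵥ* N := by
  have h : vecMulCoeff N k a = fun lj => ((a ᵥ* N) lj.2).coeff lj.1 := rfl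
  rw [h]
  exact polyVec_coeff (degree_vecMul_lt ha)

lemma exists_linearMap_pi_degreeLT {n : ℕ} {W : Type*} [AddCommGroup W] [Module F W]
    (L : (Fin n → F[X]) →ₗ[F] W) (e : Fin n → ℕ) :
    ∃ T : (∀ i, degreeLT F (e i)) →ₗ[F] W, ∀ a, T a = L fun i => a i :=
  ⟨L ∘ₗ LinearMap.piMap fun i => (degreeLT F (e i)).subtype, fun _ => rfl⟩

lemma finrank_pi_degreeLT {n : ℕ} (e : Fin n → ℕ) :
    Module.finrank F (∀ i, degreeLT F (e i)) = ∑ i, e i := by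
  have hfin : ∀ t, Module.finrank F (degreeLT F t) = t := fun t => by
    rw [(degreeLTEquiv F t).finrank_eq, Module.finrank_fin_fun]
  have : ∀ t, Module.Finite F (degreeLT F t) := fun t => .equiv (degreeLTEquiv F t).symm
  rw [Module.finrank_pi_fintype]
  simp [hfin]

/-- The dimension of the kernel of a Sylvester matrix in terms of the right minimal indices. -/
lemma finrank_ker_sylv {e k n : ℕ} {M : Matrix (Fin p) (Fin q) F[X]}
    (hdeg : ∀ i j, (M i j).natDegree ≤ e) {N : Matrix (Fin n) (Fin q) F[X]}
    (hN : IsMinimalBasisOf (rightNullSpace M) N) :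
    Module.finrank F (LinearMap.ker (sylv e k M).mulVecLin) = ∑ i, (k - rowDeg N i) := by
  obtain ⟨T, hTv⟩ := exists_linearMap_pi_degreeLT (vecMulCoeff N k) fun i => k - rowDeg N i
  have hT : ∀ a, polyVec (T a) = (fun i => (a i : F[X])) ᵥ* N := fun a => by
    rw [hTv]
    exact polyVec_vecMulCoeff fun i => (a i).2
  have hinj : Function.Injective T := by
    refine (injective_iff_map_eq_zero T).2 fun a ha => ?_
    have h := vecMul_eq_zero_of_linearIndependent hN.1 (b := fun i => (a i : F[X])) (by
      rw [← hT, ha]; ext1 j; simp [polyVec])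
    ext1 i
    exact Subtype.ext (congrFun h i)
  have hrange : LinearMap.range T = LinearMap.ker (sylv e k M).mulVecLin := by
    apply le_antisymm
    · rintro _ ⟨a, rfl⟩
      rw [LinearMap.mem_ker, Matrix.mulVecLin_apply, sylv_mulVec_eq_zero_iff hdeg, hT,
        ← mem_rightNullSpace_iff, ← hN.2.1]
      exact algebraMap_vecMul_mem_rowSpan _ _
    · intro c hc
      rw [LinearMap.mem_ker, Matrix.mulVecLin_apply, sylv_mulVec_eq_zero_iff hdeg,
        ← mem_rightNullSpace_iff] at hc
      obtain ⟨a, ha⟩ := hN.exists_eq_vecMul hc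
      have hlt : ∀ i, a i ∈ degreeLT F (k - rowDeg N i) := by
        intro i
        rw [mem_degreeLT]
        by_cases hi : a i = 0
        · simp [hi]
        · have := hN.natDegree_add_rowDeg_lt (fun j => ha ▸ degree_polyVec_lt c j) hi
          exact (natDegree_lt_iff_degree_lt hi).1 (by omega)
      refine ⟨fun i => ⟨a i, hlt i⟩, ?_⟩
      rw [hTv]
      ext1 lj
      change ((a ᵥ* N) lj.2).coeff lj.1 = _
      rw [ha, coeff_polyVec]
  rw [← hrange, LinearMap.finrank_range_of_inj hinj, finrank_pi_degreeLT]

lemma rank_sylv_add_sum {e k n : ℕ} {M : Matrix (Fin p) (Fin q) F[X]}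
    (hdeg : ∀ i j, (M i j).natDegree ≤ e) {N : Matrix (Fin n) (Fin q) F[X]}
    (hN : IsMinimalBasisOf (rightNullSpace M) N) :
    (sylv e k M).rank + ∑ i, (k - rowDeg N i) = k * q := by
  rw [← finrank_ker_sylv hdeg hN, Matrix.rank, LinearMap.finrank_range_add_finrank_ker]
  simp

/-- A minimal basis is surjective as a map between free `F[X]`-modules. -/
lemma IsMinimalBasisOf.exists_mulVec_eq {V : Submodule (RatFunc F) (Fin q → RatFunc F)}
    {M : Matrix (Fin p) (Fin q) F[X]} (hM : IsMinimalBasisOf V M) (y : Fin p → F[X]) :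
    ∃ x, M *ᵥ x = y := by
  rcases eq_top_or_exists_le_coatom (LinearMap.range M.mulVecLin) with htop | ⟨W, hW, hle⟩
  · exact LinearMap.range_eq_top.1 htop y
  exfalso
  have hsimple := isSimpleModule_iff_isCoatom.2 hW
  obtain ⟨I, hI, ⟨φ⟩⟩ := isSimpleModule_iff_quot_maximal.1 hsimple
  set ψ : (Fin p → F[X]) →ₗ[F[X]] F[X] ⧸ I := φ.toLinearMap ∘ₗ W.mkQ with hψ
  have hψM : ∀ x, ψ (M *ᵥ x) = 0 := fun x => by
    have : M *ᵥ x ∈ W := hle ⟨x, rfl⟩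
    simp [hψ, (Submodule.Quotient.mk_eq_zero W).2 this]
  choose v hv using fun i => Ideal.Quotient.mk_surjective (I := I) (ψ (Pi.single i 1))
  have hψv : ∀ x, ψ x = Ideal.Quotient.mk I (v ⬝ᵥ x) := by
    intro x
    conv_lhs => rw [pi_eq_sum_univ' x]
    simp only [map_sum, map_smul, dotProduct, map_mul, hv]
    refine Finset.sum_congr rfl fun i _ => ?_
    rw [mul_comm]
    exact Algebra.smul_def (x i) (ψ (Pi.single i 1))
  obtain ⟨g, hg⟩ := IsPrincipalIdealRing.principal I
  have hg0 : g ≠ 0 := by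
    rintro rfl
    rw [Submodule.span_zero_singleton] at hg
    exact Polynomial.not_isField F (Ring.isField_iff_maximal_bot.2 (hg ▸ hI))
  have hdvd : ∀ j, ∃ w, (v ᵥ* M) j = g * w := by
    intro j
    have h := hψM (Pi.single j 1)
    rw [hψv, Matrix.dotProduct_mulVec, dotProduct_single_one, Ideal.Quotient.eq_zero_iff_mem, hg]
      at h
    exact Ideal.mem_span_singleton.1 h
  choose w hw using hdvd
  have hgw : g • w = v ᵥ* M := funext fun j => (hw j).symm
  have hmem : (fun j => algebraMap F[X] (RatFunc F) (w j)) ∈ V := by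
    have hg' : algebraMap F[X] (RatFunc F) g ≠ 0 := by simpa using hg0
    rw [← Submodule.smul_mem_iff _ hg', ← hM.2.1]
    convert algebraMap_vecMul_mem_rowSpan M v using 1
    ext j
    simp [hw]
  obtain ⟨a, rfl⟩ := hM.exists_eq_vecMul hmem
  have hva : v = g • a := by
    refine sub_eq_zero.1 (vecMul_eq_zero_of_linearIndependent hM.1 ?_)
    rw [Matrix.sub_vecMul, Matrix.smul_vecMul, hgw, sub_self]
  have hψ0 : ψ = 0 := by
    refine LinearMap.ext fun x => ?_
    rw [LinearMap.zero_apply, hψv, hva, Ideal.Quotient.eq_zero_iff_mem, hg, smul_dotProduct]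
    exact Ideal.mem_span_singleton.2 (Dvd.intro _ rfl)
  have hsurj : Function.Surjective ψ := φ.surjective.comp W.mkQ_surjective
  obtain ⟨x, hx⟩ := hsurj 1
  rw [hψ0] at hx
  exact hI.ne_top ((Ideal.Quotient.zero_eq_one_iff).1 hx)

/-- Division with remainder by `M` when its coefficient matrix of degree `d` is surjective. -/
lemma exists_degree_sub_mulVec_lt {d : ℕ} {M : Matrix (Fin p) (Fin q) F[X]}
    (hdeg : ∀ i j, (M i j).natDegree ≤ d) (hM : Function.Surjective (coeffMat d M).mulVec)
    (k : ℕ) (y : Fin p → F[X]) (hy : ∀ i, (y i).degree < ((k + d : ℕ) : WithBot ℕ)) :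
    ∃ x : Fin q → F[X], (∀ j, (x j).degree < k) ∧ ∀ i, ((y - M *ᵥ x) i).degree < d := by
  induction k generalizing y with
  | zero => exact ⟨0, by simp, by simpa using hy⟩
  | succ k ih =>
    obtain ⟨g, hg⟩ := hM fun i => (y i).coeff (k + d)
    set x₀ : Fin q → F[X] := fun j => C (g j) * X ^ k with hx₀
    have hx₀lt : ∀ j, (x₀ j).degree < ((k + 1 : ℕ) : WithBot ℕ) := fun j =>
      (degree_C_mul_X_pow_le k (g j)).trans_lt (Nat.cast_lt.2 k.lt_succ_self)
    obtain ⟨x, hx, hxy⟩ := ih (y - M *ᵥ x₀) fun i => by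
      rw [degree_lt_iff_coeff_zero]
      intro t ht
      rw [Pi.sub_apply, coeff_sub]
      rcases ht.eq_or_lt with rfl | ht
      · rw [sub_eq_zero, ← congrFun hg i]
        simp only [Matrix.mulVec, dotProduct, finsetSum_coeff]
        refine Finset.sum_congr rfl fun j _ => ?_
        rw [hx₀, ← mul_assoc, add_comm k d, coeff_mul_X_pow, coeff_mul_C, coeffMat]
      · rw [(degree_lt_iff_coeff_zero _ _).1 (hy i) t (by omega),
          (degree_lt_iff_coeff_zero _ _).1 (degree_mulVec_lt hdeg hx₀lt i) t (by omega), sub_zero]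
    refine ⟨x₀ + x, fun j => (degree_add_le _ _).trans_lt (max_lt (hx₀lt j) ((hx j).trans ?_)), ?_⟩
    · exact Nat.cast_lt.2 k.lt_succ_self
    · rwa [Matrix.mulVec_add, ← sub_sub]

lemma rank_sylv_eq_of_exists_preimage {d k : ℕ} {M : Matrix (Fin p) (Fin q) F[X]}
    (hdeg : ∀ i j, (M i j).natDegree ≤ d) (hM : (coeffMat d M).rank = p)
    (h : ∀ y : Fin p → F[X], (∀ i, (y i).degree < d) →
      ∃ x : Fin q → F[X], (∀ j, (x j).degree < k) ∧ M *ᵥ x = y) :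
    (sylv d k M).rank = (k + d) * p := by
  have hsurj := rank_eq_card_iff_mulVec_surjective.1 (hM.trans (Fintype.card_fin p).symm)
  rw [rank_sylv_eq_iff hdeg]
  intro y hy
  obtain ⟨x, hx, hxy⟩ := exists_degree_sub_mulVec_lt hdeg hsurj k y hy
  obtain ⟨z, hz, hzy⟩ := h _ hxy
  refine ⟨x + z, fun j => (degree_add_le _ _).trans_lt (max_lt (hx j) (hz j)), ?_⟩
  rw [Matrix.mulVec_add, hzy, add_sub_cancel]

lemma exists_mul_eq_one_of_mulVec_surjective {M : Matrix (Fin p) (Fin q) F[X]}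
    (hM : Function.Surjective M.mulVec) : ∃ R : Matrix (Fin q) (Fin p) F[X], M * R = 1 :=
  Matrix.mulVec_surjective_iff_exists_right_inverse.1 hM

lemma IsMinimalBasis.exists_rank_sylv {d : ℕ} {M : Matrix (Fin p) (Fin q) F[X]}
    (hdeg : ∀ i j, (M i j).natDegree ≤ d) (hmin : IsMinimalBasis M)
    (hM : (coeffMat d M).rank = p) : ∃ k : ℕ, 1 ≤ k ∧ (sylv d k M).rank = (k + d) * p := by
  obtain ⟨R, hR⟩ := exists_mul_eq_one_of_mulVec_surjective hmin.exists_mulVec_eq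
  set D := Finset.univ.sup (rowDeg R) with hD
  refine ⟨d + D + 1, by omega, rank_sylv_eq_of_exists_preimage hdeg hM fun y hy => ?_⟩
  have hR' : ∀ i j, (R i j).natDegree ≤ D := fun i j =>
    (natDegree_le_rowDeg R i j).trans (Finset.le_sup (Finset.mem_univ i))
  refine ⟨R *ᵥ y, fun j => (degree_mulVec_lt hR' hy j).trans ?_, ?_⟩
  · exact Nat.cast_lt.2 (Nat.lt_succ_self _)
  · rw [Matrix.mulVec_mulVec, hR, Matrix.one_mulVec]

lemma rank_coeffMat_of_rank_sylv {d k : ℕ} {M : Matrix (Fin p) (Fin q) F[X]}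
    (hdeg : ∀ i j, (M i j).natDegree ≤ d) (hk : 1 ≤ k)
    (h : (sylv d k M).rank = (k + d) * p) : (coeffMat d M).rank = p := by
  rw [rank_sylv_eq_iff hdeg] at h
  refine Eq.trans (rank_eq_card_iff_mulVec_surjective.2 fun z => ?_) (Fintype.card_fin p)
  obtain ⟨x, hx, hxz⟩ := h (fun i => C (z i) * X ^ (k - 1 + d)) fun i =>
    (degree_C_mul_X_pow_le _ _).trans_lt (Nat.cast_lt.2 (by omega))
  refine ⟨fun j => (x j).coeff (k - 1), ?_⟩
  ext1 i
  have hi := congrArg (fun f => coeff f (d + (k - 1))) (congrFun hxz i)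
  simp only [add_comm (k - 1), coeff_C_mul_X_pow, if_true] at hi
  rw [← hi]
  simp only [Matrix.mulVec, dotProduct, finsetSum_coeff]
  refine Finset.sum_congr rfl fun j _ => Eq.symm ?_
  refine coeff_mul_add_eq_of_natDegree_le (hdeg i j) ?_
  by_cases hj : x j = 0
  · simp [hj]
  · have := (natDegree_lt_iff_degree_lt hj).2 (hx j)
    omega

lemma isMinimalBasis_of_rank_sylv {d k : ℕ} (hd : 0 < d) {M : Matrix (Fin p) (Fin q) F[X]}
    (hdeg : ∀ i j, (M i j).natDegree ≤ d) (hk : 1 ≤ k)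
    (h : (sylv d k M).rank = (k + d) * p) : IsMinimalBasis M := by
  have hlead := rank_eq_card_rows_iff.1 (rank_coeffMat_of_rank_sylv hdeg hk h)
  rw [rank_sylv_eq_iff hdeg] at h
  have hinj : ∀ a : Fin p → F[X], a ᵥ* M = 0 → a = 0 := by
    intro a ha
    by_contra hne
    obtain ⟨j, hj⟩ := exists_le_natDegree_vecMul hdeg hlead hne
    simp [ha] at hj
    omega
  choose x hx using fun i : Fin p => h (Pi.single i 1) fun l =>
    (show ((Pi.single i 1 : Fin p → F[X]) l).degree ≤ 0 by
      rw [Pi.single_apply]; split_ifs <;> simp).trans_lt (Nat.cast_pos.2 (by omega))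
  set R : Matrix (Fin q) (Fin p) F[X] := fun j i => x i j
  have hR : M * R = 1 := by
    ext1 i l
    exact (congrFun (hx l).2 i).trans (by rw [Matrix.one_apply, Pi.single_apply])
  refine ⟨?_, rfl, ?_⟩
  · rw [← LinearIndependent.iff_fractionRing F[X] (RatFunc F), Fintype.linearIndependent_iff]
    intro a ha
    refine congrFun (hinj a ?_)
    ext1 j
    apply IsFractionRing.injective F[X] (RatFunc F)
    rw [← congrFun (ratRow_combination M a) j]
    simp only [algebraMap_smul, ha]
    simp
  · intro M' hli hspan
    refine Finset.sum_le_sum fun i _ => ?_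
    have hmem : (fun j => algebraMap F[X] (RatFunc F) (M' i j)) ∈ rowSpan M := by
      rw [← hspan]
      exact Submodule.subset_span (Set.mem_range_self i)
    obtain ⟨s, b, hs, hsb⟩ := exists_smul_eq_vecMul hmem
    have hM'i : ((M' i) ᵥ* R) ᵥ* M = M' i := by
      refine smul_right_injective _ hs ?_
      simp only
      rw [← Matrix.smul_vecMul, ← Matrix.smul_vecMul, hsb, Matrix.vecMul_vecMul b M R, hR,
        Matrix.vecMul_one]
    have hne : (M' i) ᵥ* R ≠ 0 := by
      intro h0
      refine hli.ne_zero i ?_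
      rw [h0, Matrix.zero_vecMul] at hM'i
      ext j
      simp [ratRow, ← hM'i]
    obtain ⟨j, hj⟩ := exists_le_natDegree_vecMul hdeg hlead hne
    rw [hM'i] at hj
    exact (Finset.sup_le fun j _ => hdeg i j).trans (hj.trans (natDegree_le_rowDeg M' i j))

lemma rank_sylv_mono {d k l : ℕ} {M : Matrix (Fin p) (Fin q) F[X]}
    (hdeg : ∀ i j, (M i j).natDegree ≤ d) (hk : 1 ≤ k) (hkl : k ≤ l)
    (h : (sylv d k M).rank = (k + d) * p) : (sylv d l M).rank = (l + d) * p := by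
  refine rank_sylv_eq_of_exists_preimage hdeg (rank_coeffMat_of_rank_sylv hdeg hk h) fun y hy => ?_
  obtain ⟨x, hx, hxy⟩ := (rank_sylv_eq_iff hdeg).1 h y fun i =>
    (hy i).trans_le (Nat.cast_le.2 (Nat.le_add_left d k))
  exact ⟨x, fun j => (hx j).trans_le (Nat.cast_le.2 hkl), hxy⟩

/-- `M(λ)` is a minimal basis with full rank leading coefficient `M_d` if and only if
some Sylvester matrix `S_k` has full row rank `(k+d)m`; in that case the smallest such
index `d'` is the largest right minimal index of `M(λ)`. -/
theorem isMinimalBasis_leading_full_iff_exists_sylvester_full_row_rank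
    {F : Type*} [Field F] {m n d : ℕ} (hm : 0 < m) (hn : 0 < n) (hd : 0 < d)
    (M : Matrix (Fin m) (Fin (m + n)) F[X]) (hdeg : ∀ i j, (M i j).natDegree ≤ d) :
    (IsMinimalBasis M ∧ (coeffMat d M).rank = m ↔
        ∃ k : ℕ, 1 ≤ k ∧ (sylv d k M).rank = (k + d) * m) ∧
    ∀ d' : ℕ, 1 ≤ d' → (sylv d d' M).rank = (d' + d) * m →
      (∀ j : ℕ, 1 ≤ j → j < d' → (sylv d j M).rank ≠ (j + d) * m) →
      ∀ N : Matrix (Fin n) (Fin (m + n)) F[X],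
        IsMinimalBasisOf (rightNullSpace M) N →
        Finset.univ.sup (fun i => rowDeg N i) = d' := by
  refine ⟨⟨fun h => h.1.exists_rank_sylv hdeg h.2, fun ⟨k, hk, h⟩ =>
    ⟨isMinimalBasis_of_rank_sylv hd hdeg hk h, rank_coeffMat_of_rank_sylv hdeg hk h⟩⟩, ?_⟩
  intro d' hd' hfull hmin N hN
  set ε := Finset.univ.sup (fun i => rowDeg N i) with hε
  have hle : ∀ i, rowDeg N i ≤ ε := fun i =>
    Finset.le_sup (f := fun i => rowDeg N i) (Finset.mem_univ i)
  have hsum : ∀ k, ε ≤ k → ∑ i, (k - rowDeg N i) + ∑ i, rowDeg N i = k * n := by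
    intro k hk
    rw [← Finset.sum_add_distrib, Finset.sum_congr rfl fun i _ =>
      Nat.sub_add_cancel ((hle i).trans hk)]
    simp [mul_comm]
  have htotal : ∑ i, rowDeg N i = d * m := by
    have h1 := rank_sylv_add_sum (k := max d' ε) hdeg hN
    rw [rank_sylv_mono hdeg hd' (le_max_left d' ε) hfull] at h1
    have h2 := hsum _ (le_max_right d' ε)
    nlinarith
  apply le_antisymm
  · refine Finset.sup_le fun i _ => ?_
    by_contra! hlt
    have h1 := rank_sylv_add_sum (k := d') hdeg hN
    rw [hfull] at h1
    have h2 : ∑ i : Fin n, d' < ∑ i, ((d' - rowDeg N i) + rowDeg N i) :=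
      Finset.sum_lt_sum (fun l _ => by omega) ⟨i, Finset.mem_univ i, by omega⟩
    rw [Finset.sum_add_distrib, htotal] at h2
    simp only [Finset.sum_const, Finset.card_univ, Fintype.card_fin, smul_eq_mul] at h2
    nlinarith
  · by_contra! hlt
    have hpos : 1 ≤ ε := by
      by_contra! h0
      have hz : ∑ i, rowDeg N i = 0 := Finset.sum_eq_zero fun i _ => by
        have := hle i
        omega
      have := Nat.mul_pos hd hm
      omega
    refine hmin ε hpos hlt ?_
    have h1 := rank_sylv_add_sum (k := ε) hdeg hN
    have h2 := hsum ε le_rfl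
    nlinarith

end
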